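/- Fix b ∈ (0, ∞], indices 1 < p ≤ q < ∞, and weights u, v on I_b = (0, b). Then the least constant C > 0 in the inequality (∫₀ᵇ (u(t)·(Pf)(t))^q dt)^{1/q} ≤ C (∫₀ᵇ (v(t) f(t))^p dt)^{1/p}, required to hold for all f ∈ M₊(I_b), is equivalent (up to multiplicative constants depending only on p and q) to sup_{0<r<b} (∫ᵣᵇ (u(t)/t)^q dt)^{1/q} (∫₀ʳ v(t)^{-p'} dt)^{1/p'}; in particular, the inequality holds with some finite C if and only if this supremum is finite. -/

import Mathlib

open MeasureTheory Set ENNReal Filter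

noncomputable section

/-- The interval `I_b = (0, b)` for `b ∈ (0, ∞]`, as a subset of `ℝ`. -/
def IbSet (b : ℝ≥0∞) : Set ℝ := {t : ℝ | 0 < t ∧ ENNReal.ofReal t < b}

/-- `∫₀ᵗ φ`. -/
def intPhi (φ : ℝ → ℝ≥0∞) (t : ℝ) : ℝ≥0∞ := ∫⁻ s in Ioo (0 : ℝ) t, φ s

/-- `∫ₜᵇ φ(s) s^(-p) ds`. -/
def tailP (b : ℝ≥0∞) (p : ℝ) (φ : ℝ → ℝ≥0∞) (t : ℝ) : ℝ≥0∞ :=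
  ∫⁻ s in {s : ℝ | t < s ∧ ENNReal.ofReal s < b}, φ s * ENNReal.ofReal (s ^ (-p))

/-- `∫₀ᵗ φ + tᵖ ∫ₜᵇ φ(s) s^(-p) ds`. -/
def DPhi (b : ℝ≥0∞) (p : ℝ) (φ : ℝ → ℝ≥0∞) (t : ℝ) : ℝ≥0∞ :=
  intPhi φ t + ENNReal.ofReal (t ^ p) * tailP b p φ t

/-- The Hardy averaging operator `P`. -/
def Pavg (g : ℝ → ℝ≥0∞) (t : ℝ) : ℝ≥0∞ := (ENNReal.ofReal t)⁻¹ * ∫⁻ s in Ioo (0 : ℝ) t, g s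

/-- The dual Hardy operator `Q`, `(Qg)(t) = ∫ₜᵇ g(s) s⁻¹ ds`. -/
def Qavg (b : ℝ≥0∞) (g : ℝ → ℝ≥0∞) (t : ℝ) : ℝ≥0∞ :=
  ∫⁻ s in {s : ℝ | t < s ∧ ENNReal.ofReal s < b}, g s * (ENNReal.ofReal s)⁻¹

/-- The operator `Q_p`, `(Q_p g)(t) = p t^(p-1) ∫ₜᵇ g(s) s^(-p) ds`. -/
def Qp (b : ℝ≥0∞) (p : ℝ) (g : ℝ → ℝ≥0∞) (t : ℝ) : ℝ≥0∞ :=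
  ENNReal.ofReal (p * t ^ (p - 1)) *
    ∫⁻ s in {s : ℝ | t < s ∧ ENNReal.ofReal s < b}, g s * ENNReal.ofReal (s ^ (-p))

/-- `(PQ_p)(φ)(t) = t⁻¹ [∫₀ᵗ φ + tᵖ ∫ₜᵇ φ(s) s^(-p) ds]`. -/
def PQp (b : ℝ≥0∞) (p : ℝ) (φ : ℝ → ℝ≥0∞) (t : ℝ) : ℝ≥0∞ :=
  (ENNReal.ofReal t)⁻¹ * DPhi b p φ t

/-- A weight on `I_b`: a positive, finite, locally integrable function. -/
def IsWeight (b : ℝ≥0∞) (φ : ℝ → ℝ≥0∞) : Prop :=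
  Measurable φ ∧ (∀ t ∈ IbSet b, 0 < φ t ∧ φ t < ⊤) ∧
    ∀ a c : ℝ, 0 < a → ENNReal.ofReal c < b → ∫⁻ t in Icc a c, φ t < ⊤

/-- A non-trivial weight on `I_b` for the index `p`. -/
def IsNontrivialWeight (b : ℝ≥0∞) (p : ℝ) (φ : ℝ → ℝ≥0∞) : Prop :=
  IsWeight b φ ∧
    (b = ⊤ → ∫⁻ t in Ioi (1 : ℝ), φ t * ENNReal.ofReal (t ^ (-p)) < ⊤) ∧
    tailP b p φ 0 = ⊤

/-- The dual weight `ψ(t) = t^(p+p'-1) (∫₀ᵗ φ)(∫ₜᵇ φ(s)s^(-p) ds)/D(t)^(p'+1)`. -/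
def dualWeight (b : ℝ≥0∞) (p : ℝ) (φ : ℝ → ℝ≥0∞) (t : ℝ) : ℝ≥0∞ :=
  ENNReal.ofReal (t ^ (p + p / (p - 1) - 1)) * intPhi φ t * tailP b p φ t /
    (DPhi b p φ t) ^ (p / (p - 1) + 1)

/-- `ψ = (Pφ)(Q_pφ)/[(PQ_p)(φ)]^(p'+1)`. -/
def dualWeight' (b : ℝ≥0∞) (p : ℝ) (φ : ℝ → ℝ≥0∞) (t : ℝ) : ℝ≥0∞ :=
  Pavg φ t * Qp b p φ t / (PQp b p φ t) ^ (p / (p - 1) + 1)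

/-- The decreasing rearrangement `f*`. -/
def decRearr {α : Type*} [MeasurableSpace α] (μ : Measure α) (f : α → ℝ) (t : ℝ) : ℝ≥0∞ :=
  sInf {l : ℝ≥0∞ | μ {x | l < (‖f x‖₊ : ℝ≥0∞)} ≤ ENNReal.ofReal t}

/-- `f**(t) = t⁻¹ ∫₀ᵗ f*`. -/
def avgRearr {α : Type*} [MeasurableSpace α] (μ : Measure α) (f : α → ℝ) (t : ℝ) : ℝ≥0∞ :=
  (ENNReal.ofReal t)⁻¹ * ∫⁻ s in Ioo (0 : ℝ) t, decRearr μ f s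

/-- The Lorentz Gamma functional `ρ_{p,φ}(f) = (∫_{I_b} f**(t)^p φ(t) dt)^(1/p)`. -/
def rhoGamma {α : Type*} [MeasurableSpace α] (μ : Measure α) (b : ℝ≥0∞) (p : ℝ)
    (φ : ℝ → ℝ≥0∞) (f : α → ℝ) : ℝ≥0∞ :=
  (∫⁻ t in IbSet b, (avgRearr μ f t) ^ p * φ t) ^ (1 / p)

/-- The Stieltjes operator `(Sg)(t) = ∫₀^∞ g(s)/(s+t) ds`. -/
def Sop (g : ℝ → ℝ≥0∞) (t : ℝ) : ℝ≥0∞ :=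
  ∫⁻ s in Ioi (0 : ℝ), g s / ENNReal.ofReal (s + t)

/-- Lebesgue measure on `(0,∞)`. -/
def mu0 : Measure ℝ := volume.restrict (Ioi (0 : ℝ))

/-- The Muckenhoupt-type constant for the Hardy operator `P`. -/
def HardyConstP (b : ℝ≥0∞) (p q : ℝ) (u v : ℝ → ℝ≥0∞) : ℝ≥0∞ :=
  ⨆ (r : ℝ) (_ : r ∈ IbSet b),
    (∫⁻ t in {t : ℝ | r < t ∧ ENNReal.ofReal t < b}, (u t / ENNReal.ofReal t) ^ q) ^ (1 / q) *
      (∫⁻ t in Ioo (0 : ℝ) r, (v t) ^ (-(p / (p - 1)))) ^ (1 / (p / (p - 1)))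

lemma isOpen_tail (b : ℝ≥0∞) (r : ℝ) : IsOpen {t : ℝ | r < t ∧ ENNReal.ofReal t < b} :=
  (isOpen_lt continuous_const continuous_id).inter
    (isOpen_lt ENNReal.continuous_ofReal continuous_const)

lemma measurableSet_IbSet (b : ℝ≥0∞) : MeasurableSet (IbSet b) :=
  (isOpen_tail b 0).measurableSet

lemma tail_nonempty {b : ℝ≥0∞} {r : ℝ} (hr : 0 ≤ r) (hb : ENNReal.ofReal r < b) :
    {t : ℝ | r < t ∧ ENNReal.ofReal t < b}.Nonempty := by
  obtain ⟨c, h1, h2⟩ := ENNReal.lt_iff_exists_nnreal_btwn.1 hb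
  refine ⟨c, ?_, by simpa using h2⟩
  rw [← ENNReal.ofReal_coe_nnreal] at h1
  exact (ENNReal.ofReal_lt_ofReal_iff_of_nonneg hr).1 h1

lemma setLInt_ne_zero {S : Set ℝ} (hS : IsOpen S) (hne : S.Nonempty) {g : ℝ → ℝ≥0∞}
    (hg : Measurable g) (h : ∀ t ∈ S, 0 < g t) : ∫⁻ t in S, g t ≠ 0 := by
  refine (((setLIntegral_pos_iff hg).2 ?_)).ne'
  have : Function.support g ∩ S = S := inter_eq_right.2 fun t ht => (h t ht).ne'
  rw [this]
  exact hS.measure_pos _ hne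

lemma tsum_rpow_le {ι : Type*} (a : ι → ℝ≥0∞) {s : ℝ} (hs : 1 ≤ s) :
    ∑' i, a i ^ s ≤ (∑' i, a i) ^ s := by
  have h : ∀ x : ℝ≥0∞, x ^ s = x * x ^ (s - 1) := fun x => by
    conv_lhs => rw [show s = 1 + (s - 1) by ring,
      ENNReal.rpow_add_of_nonneg _ _ zero_le_one (by linarith), ENNReal.rpow_one]
  rw [h, ← ENNReal.tsum_mul_right]
  refine ENNReal.tsum_le_tsum fun i => ?_
  rw [h]
  exact mul_le_mul_right (ENNReal.rpow_le_rpow (ENNReal.le_tsum i) (by linarith)) _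

lemma intPhi_mono (f : ℝ → ℝ≥0∞) : Monotone (intPhi f) := fun _ _ h =>
  lintegral_mono_set (Ioo_subset_Ioo_right h)

lemma intPhi_ivt {f : ℝ → ℝ≥0∞} (hf : Measurable f) {c : ℝ} (hc : 0 ≤ c)
    (hfin : intPhi f c ≠ ⊤) {a : ℝ≥0∞} (ha : a ≤ intPhi f c) :
    ∃ z ∈ Icc 0 c, intPhi f z = a := by
  have hI : ∀ t ∈ Icc 0 c, (intPhi f t).toReal = ∫ s in (0:ℝ)..t, (f s).toReal := by
    intro t ht
    have hft : intPhi f t ≠ ⊤ := ne_top_of_le_ne_top hfin (intPhi_mono f ht.2)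
    rw [intervalIntegral.integral_of_le ht.1, integral_Ioc_eq_integral_Ioo,
      integral_toReal hf.aemeasurable (ae_lt_top hf hft)]
    rfl
  have hint : IntervalIntegrable (fun s => (f s).toReal) volume 0 c := by
    rw [intervalIntegrable_iff_integrableOn_Ioo_of_le hc]
    exact integrable_toReal_of_lintegral_ne_top hf.aemeasurable hfin
  have hcont : ContinuousOn (fun t => (intPhi f t).toReal) (Icc 0 c) := by
    have := intervalIntegral.continuousOn_primitive_interval' hint left_mem_uIcc
    rw [uIcc_of_le hc] at this
    exact this.congr hI
  have h0 : intPhi f 0 = 0 := by simp [intPhi]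
  have hatop : a ≠ ⊤ := ne_top_of_le_ne_top hfin ha
  obtain ⟨z, hz, hza⟩ := intermediate_value_Icc hc hcont
    (show a.toReal ∈ Icc _ _ from ⟨by simp [h0], ENNReal.toReal_mono hfin ha⟩)
  exact ⟨z, hz, (ENNReal.toReal_eq_toReal_iff'
    (ne_top_of_le_ne_top hfin (intPhi_mono f hz.2)) hatop).1 hza⟩

/-- Hölder on a set where the weight is positive and finite. -/
lemma holder_weight {p : ℝ} (hp : 1 < p) {S : Set ℝ} (hS : MeasurableSet S) {v f : ℝ → ℝ≥0∞}
    (hv : Measurable v) (hf : Measurable f) (h : ∀ t ∈ S, 0 < v t ∧ v t < ⊤) :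
    ∫⁻ t in S, f t ≤ (∫⁻ t in S, (v t * f t) ^ p) ^ (1 / p) *
      (∫⁻ t in S, (v t) ^ (-(p / (p - 1)))) ^ (1 / (p / (p - 1))) := by
  have hconj : p.HolderConjugate (p / (p - 1)) := Real.HolderConjugate.conjExponent hp
  have := ENNReal.lintegral_mul_le_Lp_mul_Lq (volume.restrict S) hconj
    (f := fun t => v t * f t) (g := fun t => (v t)⁻¹) (hv.mul hf).aemeasurable
    hv.inv.aemeasurable
  simp only [ENNReal.inv_rpow, ← ENNReal.rpow_neg] at this
  refine le_trans (le_of_eq ?_) this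
  refine setLIntegral_congr_fun hS fun t ht => ?_
  simp only [Pi.mul_apply]
  rw [mul_comm (v t), mul_assoc, ENNReal.mul_inv_cancel (h t ht).1.ne' (h t ht).2.ne, mul_one]

lemma lower_bound {p q : ℝ} (hp : 1 < p) (hpq : p ≤ q) {b : ℝ≥0∞} {u v : ℝ → ℝ≥0∞}
    (hu : IsWeight b u) (hv : IsWeight b v) {K : ℝ≥0∞}
    (hK : ∀ f : ℝ → ℝ≥0∞, Measurable f →
            (∫⁻ t in IbSet b, (u t * Pavg f t) ^ q) ^ (1 / q) ≤
              K * (∫⁻ t in IbSet b, (v t * f t) ^ p) ^ (1 / p)) :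
    HardyConstP b p q u v ≤ K := by
  have hq : 0 < q := by linarith
  have hp0 : 0 < p := by linarith
  have hconj : p.HolderConjugate (p / (p - 1)) := Real.HolderConjugate.conjExponent hp
  set p' := p / (p - 1) with hp'
  have hp'0 : 0 < p' := hconj.symm.pos
  refine iSup₂_le fun r hr => ?_
  set U := ∫⁻ t in {t : ℝ | r < t ∧ ENNReal.ofReal t < b}, (u t / ENNReal.ofReal t) ^ q with hU
  have hsub : Ioo 0 r ⊆ IbSet b := fun t ht =>
    ⟨ht.1, (ENNReal.ofReal_le_ofReal ht.2.le).trans_lt hr.2⟩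
  let S : ℕ → Set ℝ := fun n => Ioo 0 r ∩ {t | ((n : ℝ≥0∞) + 1)⁻¹ < v t}
  have hSm : ∀ n, MeasurableSet (S n) := fun n =>
    measurableSet_Ioo.inter (measurableSet_lt measurable_const hv.1)
  have hSmono : Monotone S := fun m n hmn t ht => ⟨ht.1, by
    refine lt_of_le_of_lt ?_ (show ((m : ℝ≥0∞) + 1)⁻¹ < v t from ht.2)
    gcongr⟩
  have hSU : ⋃ n, S n = Ioo 0 r := by
    refine subset_antisymm (iUnion_subset fun n => inter_subset_left) fun t ht => ?_
    obtain ⟨n, hn⟩ := ENNReal.exists_inv_nat_lt (hv.2.1 t (hsub ht)).1.ne'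
    refine mem_iUnion.2 ⟨n, ht, lt_of_le_of_lt ?_ hn⟩
    gcongr
    exact le_self_add
  let W : ℕ → ℝ≥0∞ := fun n => ∫⁻ t in S n, (v t) ^ (-p')
  have hWtop : ∀ n, W n ≠ ⊤ := by
    intro n
    refine ne_top_of_le_ne_top ?_ (setLIntegral_mono (s := S n) (μ := volume)
      (g := fun _ => ((n : ℝ≥0∞) + 1) ^ p') measurable_const fun t ht => ?_)
    · rw [setLIntegral_const]
      refine ENNReal.mul_ne_top (ENNReal.rpow_ne_top_of_nonneg hp'0.le (by simp)) ?_
      exact ne_top_of_le_ne_top (by simp) (measure_mono (inter_subset_left : S n ⊆ Ioo 0 r))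
    · rw [ENNReal.rpow_neg, ← ENNReal.inv_rpow]
      refine ENNReal.rpow_le_rpow ?_ hp'0.le
      exact (ENNReal.inv_lt_iff_inv_lt.1 ht.2).le
  have key : ∀ n, U ^ (1 / q) * W n ^ (1 / p') ≤ K := by
    intro n
    by_cases hW0 : W n = 0
    · rw [hW0, ENNReal.zero_rpow_of_pos (by positivity), mul_zero]; exact zero_le
    have h1 := hK ((S n).indicator fun t => (v t) ^ (-p'))
      ((hv.1.pow_const _).indicator (hSm n))
    have h2 : ∫⁻ t in IbSet b, (v t * (S n).indicator (fun t => (v t) ^ (-p')) t) ^ p ≤ W n := by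
      have : ∀ t, (v t * (S n).indicator (fun t => (v t) ^ (-p')) t) ^ p =
          (S n).indicator (fun t => (v t) ^ (-p')) t := by
        intro t
        by_cases ht : t ∈ S n
        · simp only [indicator_of_mem ht]
          have hvt := hv.2.1 t (hsub ht.1)
          conv_lhs => enter [1, 1]; rw [← ENNReal.rpow_one (v t)]
          rw [← ENNReal.rpow_add _ _ hvt.1.ne' hvt.2.ne, ← ENNReal.rpow_mul]
          congr 1
          rw [hp']
          have : p - 1 ≠ 0 := by linarith
          field_simp
          ring
        · simp [indicator_of_notMem ht, hp0]
      simp_rw [this]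
      refine (setLIntegral_le_lintegral _ _).trans ?_
      rw [lintegral_indicator (hSm n)]
    have h3 : U ^ (1 / q) * W n ≤ (∫⁻ t in IbSet b,
        (u t * Pavg ((S n).indicator fun t => (v t) ^ (-p')) t) ^ q) ^ (1 / q) := by
      have e : W n = (W n ^ q) ^ (1 / q) := by
        rw [← ENNReal.rpow_mul, mul_one_div_cancel hq.ne', ENNReal.rpow_one]
      rw [e, ← ENNReal.mul_rpow_of_nonneg _ _ (by positivity)]
      refine ENNReal.rpow_le_rpow ?_ (by positivity)
      rw [hU, ← lintegral_mul_const' _ _ (ENNReal.rpow_ne_top_of_nonneg hq.le (hWtop n))]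
      have hsub2 : {t : ℝ | r < t ∧ ENNReal.ofReal t < b} ⊆ IbSet b := fun t ht =>
        ⟨hr.1.trans ht.1, ht.2⟩
      refine le_trans (le_of_eq ?_) (lintegral_mono_set hsub2)
      refine setLIntegral_congr_fun (isOpen_tail b r).measurableSet fun t ht => ?_
      have : ∫⁻ s in Ioo 0 t, (S n).indicator (fun t => (v t) ^ (-p')) s = W n := by
        rw [setLIntegral_indicator (hSm n)]
        congr 2
        exact inter_eq_left.2 fun s hs => ⟨hs.1.1, hs.1.2.trans ht.1⟩
      simp only [Pavg]
      rw [this, ← ENNReal.mul_rpow_of_nonneg _ _ hq.le, div_eq_mul_inv, mul_assoc]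
    have h4 : U ^ (1 / q) * W n ^ (1 / p') * W n ^ (1 / p) ≤ K * W n ^ (1 / p) := by
      have e : W n ^ (1 / p') * W n ^ (1 / p) = W n := by
        rw [← ENNReal.rpow_add _ _ hW0 (hWtop n)]
        have := hconj.symm.inv_add_inv_eq_one
        rw [one_div, one_div, this, ENNReal.rpow_one]
      rw [mul_assoc, e]
      refine h3.trans (h1.trans ?_)
      gcongr
    exact (ENNReal.mul_le_mul_iff_left
      (by simp [ENNReal.rpow_eq_zero_iff, hW0, hWtop n])
      (ENNReal.rpow_ne_top_of_nonneg (by positivity) (hWtop n))).1 h4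
  have hV : ∫⁻ t in Ioo (0 : ℝ) r, (v t) ^ (-p') = ⨆ n, W n := by
    rw [← hSU, setLIntegral_iUnion_of_directed _ hSmono.directed_le]
  rw [hV]
  have := (ENNReal.orderIsoRpow (1 / p') (by positivity)).map_iSup W
  simp only [ENNReal.orderIsoRpow_apply] at this
  rw [this, ENNReal.mul_iSup]
  exact iSup_le key

lemma upper_bound {p q : ℝ} (hp : 1 < p) (hpq : p ≤ q) {b : ℝ≥0∞} (hb : 0 < b)
    {u v : ℝ → ℝ≥0∞} (hu : IsWeight b u) (hv : IsWeight b v) {f : ℝ → ℝ≥0∞}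
    (hf : Measurable f) :
    (∫⁻ t in IbSet b, (u t * Pavg f t) ^ q) ^ (1 / q) ≤
      8 * HardyConstP b p q u v * (∫⁻ t in IbSet b, (v t * f t) ^ p) ^ (1 / p) := by
  have hq : 0 < q := by linarith
  have hp0 : 0 < p := by linarith
  have hconj : p.HolderConjugate (p / (p - 1)) := Real.HolderConjugate.conjExponent hp
  have hp'0 : 0 < p / (p - 1) := hconj.symm.pos
  set A := ∫⁻ t in IbSet b, (v t * f t) ^ p with hA
  set H := HardyConstP b p q u v with hH
  let U : ℝ → ℝ≥0∞ := fun r =>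
    ∫⁻ t in {t : ℝ | r < t ∧ ENNReal.ofReal t < b}, (u t / ENNReal.ofReal t) ^ q
  let V : ℝ → ℝ≥0∞ := fun r => ∫⁻ t in Ioo (0 : ℝ) r, (v t) ^ (-(p / (p - 1)))
  have hUV : ∀ r ∈ IbSet b, U r ^ (1 / q) * V r ^ (1 / (p / (p - 1))) ≤ H := fun r hr =>
    le_iSup₂ (f := fun (r : ℝ) (_ : r ∈ IbSet b) =>
      U r ^ (1 / q) * V r ^ (1 / (p / (p - 1)))) r hr
  have hsub : ∀ r ∈ IbSet b, Ioo 0 r ⊆ IbSet b := fun r hr t ht =>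
    ⟨ht.1, (ENNReal.ofReal_le_ofReal ht.2.le).trans_lt hr.2⟩
  have hU0 : ∀ r ∈ IbSet b, U r ≠ 0 := fun r hr =>
    setLInt_ne_zero (isOpen_tail b r) (tail_nonempty hr.1.le hr.2)
      ((hu.1.div ENNReal.measurable_ofReal).pow_const _) fun t ht =>
        ENNReal.rpow_pos_of_nonneg (ENNReal.div_pos (hu.2.1 t ⟨hr.1.trans ht.1, ht.2⟩).1.ne'
          ENNReal.ofReal_ne_top) hq.le
  have hV0 : ∀ r ∈ IbSet b, V r ≠ 0 := fun r hr =>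
    setLInt_ne_zero isOpen_Ioo (nonempty_Ioo.2 hr.1) (hv.1.pow_const _) fun t ht => by
      rw [ENNReal.rpow_neg]
      exact ENNReal.inv_pos.2 (ENNReal.rpow_ne_top_of_nonneg hp'0.le
        (hv.2.1 t (hsub r hr ht)).2.ne)
  have hH0 : H ≠ 0 := by
    obtain ⟨r, hr⟩ := tail_nonempty (b := b) (r := 0) le_rfl (by simpa using hb)
    intro h0
    have := hUV r hr
    rw [h0, nonpos_iff_eq_zero, mul_eq_zero, ENNReal.rpow_eq_zero_iff_of_pos (by positivity),
      ENNReal.rpow_eq_zero_iff_of_pos (by positivity)] at this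
    exact this.elim (hU0 r hr) (hV0 r hr)
  have hPF : ∀ t, u t * Pavg f t = u t / ENNReal.ofReal t * intPhi f t := fun t => by
    rw [Pavg, intPhi, div_eq_mul_inv, mul_assoc]
  by_cases hA0 : A = 0
  · -- `f` vanishes almost everywhere
    have h1 : ∀ᵐ t ∂(volume.restrict (IbSet b)), f t = 0 := by
      have h2 := (lintegral_eq_zero_iff ((hv.1.mul hf).pow_const p)).1 hA0
      filter_upwards [h2, ae_restrict_mem (measurableSet_IbSet b)] with t ht ht'
      have h3 : (v t * f t) ^ p = 0 := ht
      rw [ENNReal.rpow_eq_zero_iff_of_pos hp0, mul_eq_zero] at h3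
      exact h3.resolve_left (hv.2.1 t ht').1.ne'
    have h2 : ∫⁻ t in IbSet b, f t = 0 := (lintegral_eq_zero_iff hf).2 h1
    have h3 : ∫⁻ t in IbSet b, (u t * Pavg f t) ^ q = 0 := by
      rw [← lintegral_zero (μ := volume.restrict (IbSet b))]
      refine setLIntegral_congr_fun (measurableSet_IbSet b) fun t ht => ?_
      have : intPhi f t = 0 := le_antisymm
        ((lintegral_mono_set (hsub t ht)).trans h2.le) zero_le
      simp only [hPF, this, mul_zero, ENNReal.zero_rpow_of_pos hq]
    rw [h3, ENNReal.zero_rpow_of_pos (by positivity)]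
    exact zero_le
  by_cases hAt : A = ⊤
  · rw [hAt, ENNReal.top_rpow_of_pos (by positivity), ENNReal.mul_top (mul_ne_zero (by simp) hH0)]
    exact le_top
  by_cases hHt : H = ⊤
  · rw [hHt, ENNReal.mul_top (by simp), ENNReal.top_mul]
    · exact le_top
    · rw [Ne, ENNReal.rpow_eq_zero_iff_of_pos (by positivity)]; exact hA0
  have hVt : ∀ r ∈ IbSet b, V r ^ (1 / (p / (p - 1))) ≠ ⊤ := by
    intro r hr h
    have := hUV r hr
    rw [h, ENNReal.mul_top, top_le_iff] at this
    · exact hHt this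
    · rw [Ne, ENNReal.rpow_eq_zero_iff_of_pos (by positivity)]; exact hU0 r hr
  have hFt : ∀ r ∈ IbSet b, intPhi f r ≠ ⊤ := by
    intro r hr
    refine ne_top_of_le_ne_top ?_ (holder_weight hp measurableSet_Ioo hv.1 hf
      fun t ht => hv.2.1 t (hsub r hr ht))
    refine ENNReal.mul_ne_top (ENNReal.rpow_ne_top_of_nonneg (by positivity) ?_) (hVt r hr)
    exact ne_top_of_le_ne_top hAt (lintegral_mono_set (hsub r hr))
  have hF00 : intPhi f 0 = 0 := by simp [intPhi]
  have h2k : ∀ k : ℤ, (2 : ℝ≥0∞) ^ k ≠ 0 := fun k => (ENNReal.zpow_pos (by simp) (by simp) k).ne'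
  have h2kt : ∀ k : ℤ, (2 : ℝ≥0∞) ^ k ≠ ⊤ := fun k =>
    (ENNReal.zpow_lt_top (by simp) (by simp) k).ne
  have h2s : ∀ k : ℤ, (2 : ℝ≥0∞) ^ (k + 1) = 2 * 2 ^ k := fun k => by
    rw [ENNReal.zpow_add (by simp) (by simp), zpow_one, mul_comm]
  have h2lt : ∀ k : ℤ, (2 : ℝ≥0∞) ^ k < 2 ^ (k + 1) := fun k => by
    rw [h2s, two_mul]
    exact ENNReal.lt_add_right (h2kt k) (h2k k)
  let E : ℤ → Set ℝ := fun k => IbSet b ∩ intPhi f ⁻¹' Ioc (2 ^ k) (2 ^ (k + 1))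
  have hEm : ∀ k, MeasurableSet (E k) := fun k =>
    (measurableSet_IbSet b).inter ((intPhi_mono f).measurable measurableSet_Ioc)
  have h2mono : ∀ {k l : ℤ}, k ≤ l → (2 : ℝ≥0∞) ^ k ≤ 2 ^ l := fun h =>
    ENNReal.zpow_le_of_le (by norm_num) h
  have hEd : Pairwise (Function.onFun Disjoint E) := by
    have aux : ∀ k l : ℤ, k < l → Disjoint (E k) (E l) := fun k l hkl =>
      disjoint_left.2 fun x hx hx' =>
        absurd (hx.2.2.trans (h2mono (by omega : k + 1 ≤ l))) (not_le.2 hx'.2.1)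
    intro k l hkl
    rcases lt_or_gt_of_ne hkl with h | h
    · exact aux k l h
    · exact (aux l k h).symm
  let e : ℤ → ℝ≥0∞ := fun k => ∫⁻ t in E k, (v t * f t) ^ p
  have hesum : ∑' k, e k ≤ A := by
    rw [← lintegral_iUnion hEm hEd]
    exact lintegral_mono_set (iUnion_subset fun k => inter_subset_left)
  have main : ∀ k, ∫⁻ t in E k, (u t * Pavg f t) ^ q ≤
      (4 * H) ^ q * (e (k - 2) + e (k - 1)) ^ (q / p) := by
    intro k
    rcases (E k).eq_empty_or_nonempty with h | ⟨x, hx⟩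
    · rw [h]; simp
    obtain ⟨z, hz, hFz⟩ := intPhi_ivt hf hx.1.1.le (hFt x hx.1) hx.2.1.le
    have hz0 : 0 < z := lt_of_le_of_ne hz.1 (by
      rintro rfl; exact h2k k (hFz.symm.trans hF00))
    have hzb : z ∈ IbSet b := ⟨hz0, (ENNReal.ofReal_le_ofReal hz.2).trans_lt hx.1.2⟩
    have hk1 : (2 : ℝ≥0∞) ^ k = 2 * 2 ^ (k - 1) := by rw [← h2s]; congr 1; ring
    obtain ⟨y, hy, hFy⟩ := intPhi_ivt (a := 2 ^ (k - 1)) hf hz.1 (hFt z hzb)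
      (by rw [hFz]; exact h2mono (by omega))
    have hy0 : 0 < y := lt_of_le_of_ne hy.1 (by
      rintro rfl; exact h2k _ (hFy.symm.trans hF00))
    have hI1 : Ico y z ⊆ Ioo 0 z := fun t ht => ⟨hy0.trans_le ht.1, ht.2⟩
    have hI2 : Ico y z ⊆ E (k - 2) ∪ E (k - 1) := by
      intro t ht
      have htb := hsub z hzb (hI1 ht)
      have l1 : 2 ^ (k - 1) ≤ intPhi f t := hFy ▸ intPhi_mono f ht.1
      have l2 : intPhi f t ≤ 2 ^ k := hFz ▸ intPhi_mono f ht.2.le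
      by_cases h : intPhi f t ≤ 2 ^ (k - 1)
      · refine Or.inl ⟨htb, lt_of_lt_of_le (h2lt _) (le_trans (h2mono (by omega)) l1), ?_⟩
        rwa [show k - 2 + 1 = k - 1 by ring]
      · refine Or.inr ⟨htb, not_le.1 h, ?_⟩
        rwa [show k - 1 + 1 = k by ring]
    have l3 : (2 : ℝ≥0∞) ^ (k - 1) ≤ ∫⁻ t in Ico y z, f t := by
      have : intPhi f z ≤ intPhi f y + ∫⁻ t in Ico y z, f t := by
        refine le_trans (lintegral_mono_set ?_) (lintegral_union_le f _ _)
        intro t ht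
        rcases lt_or_ge t y with h | h
        · exact Or.inl ⟨ht.1, h⟩
        · exact Or.inr ⟨h, ht.2⟩
      rw [hFz, hFy, hk1, two_mul] at this
      exact (ENNReal.add_le_add_iff_left (h2kt _)).1 this
    have l4 : (2 : ℝ≥0∞) ^ (k - 1) ≤
        (e (k - 2) + e (k - 1)) ^ (1 / p) * V z ^ (1 / (p / (p - 1))) := by
      refine l3.trans ((holder_weight hp measurableSet_Ico hv.1 hf
        fun t ht => hv.2.1 t (hsub z hzb (hI1 ht))).trans ?_)
      refine mul_le_mul' (ENNReal.rpow_le_rpow ?_ (by positivity))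
        (ENNReal.rpow_le_rpow (lintegral_mono_set hI1) (by positivity))
      exact (lintegral_mono_set hI2).trans (lintegral_union_le _ _ _)
    have l5 : ∫⁻ t in E k, (u t * Pavg f t) ^ q ≤ U z * (2 ^ (k + 1)) ^ q := by
      have hEk : E k ⊆ {t : ℝ | z < t ∧ ENNReal.ofReal t < b} := fun t ht =>
        ⟨(intPhi_mono f).reflect_lt (by rw [hFz]; exact ht.2.1), ht.1.2⟩
      rw [← lintegral_mul_const' _ _ (ENNReal.rpow_ne_top_of_nonneg hq.le (h2kt _))]
      refine le_trans ?_ (lintegral_mono_set hEk)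
      refine setLIntegral_mono' (hEm k) fun t ht => ?_
      rw [hPF, ENNReal.mul_rpow_of_nonneg _ _ hq.le]
      exact mul_le_mul_right (ENNReal.rpow_le_rpow ht.2.2 hq.le) _
    refine l5.trans ?_
    have eU : U z = (U z ^ (1 / q)) ^ q := by
      rw [← ENNReal.rpow_mul, one_div_mul_cancel hq.ne', ENNReal.rpow_one]
    have eE : (e (k - 2) + e (k - 1)) ^ (q / p) = ((e (k - 2) + e (k - 1)) ^ (1 / p)) ^ q := by
      rw [← ENNReal.rpow_mul]; congr 1; ring
    rw [eU, eE, ← ENNReal.mul_rpow_of_nonneg _ _ hq.le, ← ENNReal.mul_rpow_of_nonneg _ _ hq.le]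
    refine ENNReal.rpow_le_rpow ?_ hq.le
    rw [h2s, hk1]
    calc U z ^ (1 / q) * (2 * (2 * 2 ^ (k - 1)))
        ≤ U z ^ (1 / q) * (2 * (2 * ((e (k - 2) + e (k - 1)) ^ (1 / p)
            * V z ^ (1 / (p / (p - 1)))))) := by gcongr
      _ = 4 * (U z ^ (1 / q) * V z ^ (1 / (p / (p - 1)))) *
            (e (k - 2) + e (k - 1)) ^ (1 / p) := by ring
      _ ≤ _ := by gcongr; exact hUV z hzb
  have hcover : ∫⁻ t in IbSet b, (u t * Pavg f t) ^ q ≤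
      ∑' k, ∫⁻ t in E k, (u t * Pavg f t) ^ q := by
    have hs : IbSet b ⊆ (⋃ k, E k) ∪ (IbSet b ∩ intPhi f ⁻¹' {0}) := by
      intro t ht
      by_cases h : intPhi f t = 0
      · exact Or.inr ⟨ht, h⟩
      · obtain ⟨n, hn⟩ := ENNReal.exists_mem_Ioc_zpow h (hFt t ht) (y := 2)
          (by norm_num) (by simp)
        exact Or.inl (mem_iUnion.2 ⟨n, ht, hn⟩)
    refine (lintegral_mono_set hs).trans ((lintegral_union_le _ _ _).trans ?_)
    have hz : ∫⁻ t in IbSet b ∩ intPhi f ⁻¹' {0}, (u t * Pavg f t) ^ q = 0 := by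
      refine Eq.trans ?_ (lintegral_zero (μ := volume.restrict (IbSet b ∩ intPhi f ⁻¹' {0})))
      refine setLIntegral_congr_fun ((measurableSet_IbSet b).inter
        ((intPhi_mono f).measurable (measurableSet_singleton 0))) fun t ht => ?_
      have : intPhi f t = 0 := ht.2
      simp only [hPF, this, mul_zero, ENNReal.zero_rpow_of_pos hq]
    rw [hz, add_zero]
    exact lintegral_iUnion_le _ _
  have hshift : ∀ m : ℤ, ∑' k : ℤ, e (k - m) = ∑' k, e k := fun m =>
    (Equiv.subRight m).tsum_eq e
  have total : ∫⁻ t in IbSet b, (u t * Pavg f t) ^ q ≤ (4 * H) ^ q * (2 * A) ^ (q / p) := by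
    refine hcover.trans ((ENNReal.tsum_le_tsum main).trans ?_)
    rw [ENNReal.tsum_mul_left]
    refine mul_le_mul_right ((tsum_rpow_le _ ((one_le_div hp0).2 hpq)).trans ?_) _
    refine ENNReal.rpow_le_rpow ?_ (by positivity)
    rw [ENNReal.tsum_add, hshift, hshift, ← two_mul]
    gcongr
  refine (ENNReal.rpow_le_rpow total (by positivity)).trans ?_
  rw [ENNReal.mul_rpow_of_nonneg _ _ (by positivity), ← ENNReal.rpow_mul, ← ENNReal.rpow_mul,
    mul_one_div_cancel hq.ne', ENNReal.rpow_one, show q / p * (1 / q) = 1 / p by field_simp,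
    ENNReal.mul_rpow_of_nonneg _ _ (by positivity)]
  have h2 : (2 : ℝ≥0∞) ^ (1 / p) ≤ 2 := by
    conv_rhs => rw [← ENNReal.rpow_one 2]
    exact ENNReal.rpow_le_rpow_of_exponent_le (by norm_num) ((div_le_one hp0).2 hp.le)
  calc 4 * H * (2 ^ (1 / p) * A ^ (1 / p)) ≤ 4 * H * (2 * A ^ (1 / p)) := by gcongr
    _ = 8 * H * A ^ (1 / p) := by ring

theorem statement4 (p q : ℝ) (hp : 1 < p) (hpq : p ≤ q) :
    ∃ c C : ℝ, 0 < c ∧ 0 < C ∧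
      ∀ b : ℝ≥0∞, 0 < b → ∀ u v : ℝ → ℝ≥0∞, IsWeight b u → IsWeight b v →
        (∀ f : ℝ → ℝ≥0∞, Measurable f →
            (∫⁻ t in IbSet b, (u t * Pavg f t) ^ q) ^ (1 / q) ≤
              ENNReal.ofReal C * HardyConstP b p q u v *
                (∫⁻ t in IbSet b, (v t * f t) ^ p) ^ (1 / p)) ∧
        ∀ K : ℝ≥0∞, (∀ f : ℝ → ℝ≥0∞, Measurable f →
            (∫⁻ t in IbSet b, (u t * Pavg f t) ^ q) ^ (1 / q) ≤
              K * (∫⁻ t in IbSet b, (v t * f t) ^ p) ^ (1 / p)) →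
          ENNReal.ofReal c * HardyConstP b p q u v ≤ K := by
  refine ⟨1, 8, one_pos, by norm_num, fun b hb u v hu hv => ⟨fun f hf => ?_, fun K hK => ?_⟩⟩
  · rw [show ENNReal.ofReal 8 = 8 by simp]
    exact upper_bound hp hpq hb hu hv hf
  · rw [ENNReal.ofReal_one, one_mul]
    exact lower_bound hp hpq hu hv hK

end
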